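/- If the identity w ≍ w' holds in the Kauffman monoid K_3, then for every letter x the number of occurrences of x in w equals the number of occurrences of x in w'; in particular al(w) = al(w'). -/

import Mathlib

open scoped Classical

/-- Generators of the Kauffman monoid `K₃`. -/
inductive K3Gen : Type
  | h1 | h2 | c
deriving DecidableEq

namespace K3Gen

/-- The defining relations of the Kauffman monoid `K₃`:
`h₁h₂h₁ = h₁`, `h₂h₁h₂ = h₂`, `h₁² = ch₁ = h₁c`, `h₂² = ch₂ = h₂c`. -/
inductive K3Rel : FreeMonoid K3Gen → FreeMonoid K3Gen → Prop
  | braid1 : K3Rel (.of h1 * .of h2 * .of h1) (.of h1)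
  | braid2 : K3Rel (.of h2 * .of h1 * .of h2) (.of h2)
  | sq1 : K3Rel (.of h1 * .of h1) (.of c * .of h1)
  | comm1 : K3Rel (.of c * .of h1) (.of h1 * .of c)
  | sq2 : K3Rel (.of h2 * .of h2) (.of c * .of h2)
  | comm2 : K3Rel (.of c * .of h2) (.of h2 * .of c)

end K3Gen

/-- The congruence on the free monoid over the generators generated by the relations. -/
def K3Con : Con (FreeMonoid K3Gen) := conGen K3Gen.K3Rel

/-- The Kauffman monoid `K₃`. -/
def K3 : Type := K3Con.Quotient

instance : Monoid K3 := Con.monoid K3Con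

namespace K3

/-- The generator `h₁` of `K₃`. -/
def h1 : K3 := K3Con.mk' (.of .h1)
/-- The generator `h₂` of `K₃`. -/
def h2 : K3 := K3Con.mk' (.of .h2)
/-- The generator `c` of `K₃`. -/
def c : K3 := K3Con.mk' (.of .c)

end K3

/-- The identity `w ≍ w'` (words over the countably infinite alphabet `ℕ`) holds in the
monoid `M` if every monoid homomorphism from the free monoid over `ℕ` to `M` equalizes
`w` and `w'`. -/
def HoldsIn (M : Type*) [Monoid M] (w w' : List ℕ) : Prop :=
  ∀ φ : FreeMonoid ℕ →* M, φ (FreeMonoid.ofList w) = φ (FreeMonoid.ofList w')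

/-- The homomorphism `K₃ → (ℕ, *)` sending `h₁, h₂` to `0` and `c` to `2`. -/
def K3toNat : K3 →* ℕ :=
  Con.lift K3Con (FreeMonoid.lift (fun g : K3Gen => match g with
    | .h1 => (0 : ℕ) | .h2 => 0 | .c => 2)) (by
    refine Con.conGen_le.mpr ?_
    intro a b hab
    cases hab <;> simp [Con.ker_rel])

theorem K3toNat_c : K3toNat K3.c = 2 := rfl

/-- If the identity `w ≍ w'` holds in the Kauffman monoid `K₃`, then every letter
occurs the same number of times in `w` as in `w'`; in particular `al(w) = al(w')`. -/
theorem K3_holdsIn_count (w w' : List ℕ) (h : HoldsIn K3 w w') :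
    (∀ x : ℕ, w.count x = w'.count x) ∧ {x | x ∈ w} = {x | x ∈ w'} := by
  have key : ∀ (x : ℕ) (l : List ℕ),
      K3toNat (FreeMonoid.lift (fun y : ℕ => if y = x then K3.c else 1)
        (FreeMonoid.ofList l)) = 2 ^ l.count x := by
    intro x l
    induction l with
    | nil => simp
    | cons a l ih =>
      rw [FreeMonoid.ofList_cons, map_mul, map_mul, ih, FreeMonoid.lift_eval_of]
      by_cases hax : a = x
      · subst hax
        rw [if_pos rfl, K3toNat_c, List.count_cons_self, pow_succ, mul_comm]
      · rw [if_neg hax, map_one, one_mul, List.count_cons_of_ne hax]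
  have hc : ∀ x : ℕ, w.count x = w'.count x := by
    intro x
    have h1 := congrArg K3toNat (h (FreeMonoid.lift (fun y : ℕ => if y = x then K3.c else 1)))
    rw [key, key] at h1
    exact Nat.pow_right_injective le_rfl h1
  refine ⟨hc, ?_⟩
  ext x
  simp only [Set.mem_setOf_eq]
  rw [← List.count_pos_iff, ← List.count_pos_iff, hc x]
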